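/- Suppose ℛ = {0, 1} and: (Randomization) under P(·|S = e), D is independent of the pair (Y(0), Y(1)); (Positivity) P(S = e, D = d, Y = y) > 0 and P(S = o, Y = y) > 0 for all d, y ∈ {0, 1}; (Observational sample untreated) P(D = 1, S = o) = 0; (Sample exchangeability) the joint law of (Y, R) under P(·|S = e, D = d) equals the joint law of (Y, R) under P(·|S = o, D = d) whenever both conditioning events have positive probability; (Specific RSV mechanism) P(R = 1 | S = s, D = d, Y = 1) = 1 and P(R = 1 | S = s, D = d, Y = 0) = 1/2 for every s ∈ {e, o} and d ∈ {0, 1} with P(S = s, D = d, Y = 1) > 0, respectively P(S = s, D = d, Y = 0) > 0. Let g(r) := E[Y | R = r, S = o], θ̃ := E[g(R) | D = 1, S = e] − E[g(R) | D = 0, S = e] and θ := E[Y(1) − Y(0) | S = e]. Then, writing a := P(Y(0) = 1 | S = e) and b := P(Y(1) = 1 | S = e), one has θ̃ − θ = (a − b)/(a + 1); in particular θ̃ − θ > 0 when a > b and θ̃ − θ < 0 when a < b. -/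

import Mathlib

open MeasureTheory ProbabilityTheory

noncomputable section

/-- Sample indicator values: experimental (`e`) or observational (`o`). -/
inductive Sample : Type
  | e
  | o
deriving DecidableEq

instance : MeasurableSpace Sample := ⊤

/-- Real-valued indicator of a boolean (`{0,1}`-valued variable). -/
def b2r (b : Bool) : ℝ := if b then 1 else 0

/-- `CondIndepOf P R V W` : the conditional law of `R` given `V = v, W = w` agrees with
the conditional law of `R` given `V = v`, for all values with positive probability;
this is the notion of "R is conditionally independent of W given V" for variables with
countable ranges. -/
def CondIndepOf {Ω 𝓡 V W : Type*} [MeasurableSpace Ω] [MeasurableSpace 𝓡]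
    (P : Measure Ω) (R : Ω → 𝓡) (Vf : Ω → V) (Wf : Ω → W) : Prop :=
  ∀ v w, 0 < P {ω | Vf ω = v ∧ Wf ω = w} →
    (P[|{ω | Vf ω = v ∧ Wf ω = w}]).map R = (P[|{ω | Vf ω = v}]).map R

section Helpers

variable {Ω : Type*} [MeasurableSpace Ω]

lemma integral_comp_bool {Q : Measure Ω} [IsFiniteMeasure Q] {X : Ω → Bool}
    (hX : Measurable X) (f : Bool → ℝ) :
    ∫ ω, f (X ω) ∂Q = f true * Q.real {ω | X ω = true} + f false * Q.real {ω | X ω = false} := by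
  have hmap : ∫ x, f x ∂(Q.map X) = ∫ ω, f (X ω) ∂Q :=
    integral_map hX.aemeasurable (measurable_of_countable f).aestronglyMeasurable
  rw [← hmap, integral_fintype .of_finite]
  simp only [Fintype.univ_bool, Finset.sum_insert, Finset.mem_singleton, Bool.true_eq_false,
    not_false_eq_true, Finset.sum_singleton, smul_eq_mul]
  rw [map_measureReal_apply hX (measurableSet_singleton _),
    map_measureReal_apply hX (measurableSet_singleton _), mul_comm, mul_comm (f false)]
  rfl

lemma integral_b2r {Q : Measure Ω} [IsFiniteMeasure Q] {X : Ω → Bool} (hX : Measurable X) :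
    ∫ ω, b2r (X ω) ∂Q = Q.real {ω | X ω = true} := by
  rw [integral_comp_bool hX b2r]
  simp [b2r]

lemma integrable_b2r {Q : Measure Ω} [IsFiniteMeasure Q] {X : Ω → Bool} (hX : Measurable X) :
    Integrable (fun ω => b2r (X ω)) Q :=
  (Integrable.of_finite (μ := Q.map X) (f := b2r)).comp_measurable hX

lemma measurableSet_eq_bool {X : Ω → Bool} (hX : Measurable X) (x : Bool) :
    MeasurableSet {ω | X ω = x} :=
  hX (measurableSet_singleton x)

lemma cond_measureReal_apply {Q : Measure Ω} {A : Set Ω} (hA : MeasurableSet A) (B : Set Ω) :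
    (Q[|A]).real B = (Q.real A)⁻¹ * Q.real (A ∩ B) := by
  simp [measureReal_def, cond_apply hA]

lemma measureReal_split_bool {Q : Measure Ω} [IsFiniteMeasure Q] {X : Ω → Bool}
    (hX : Measurable X) (A : Set Ω) :
    Q.real A = Q.real ({ω | X ω = true} ∩ A) + Q.real ({ω | X ω = false} ∩ A) := by
  rw [← measureReal_inter_add_sdiff (s := A) (measurableSet_eq_bool hX true), Set.inter_comm]
  congr 2
  ext ω
  simp [and_comm]

lemma measureReal_false_eq {Q : Measure Ω} [IsProbabilityMeasure Q] {X : Ω → Bool}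
    (hX : Measurable X) :
    Q.real {ω | X ω = false} = 1 - Q.real {ω | X ω = true} := by
  have h := measureReal_split_bool (Q := Q) hX Set.univ
  simp only [probReal_univ, Set.inter_univ] at h
  linarith

/-- The law of a binary remotely sensed variable `R` given a binary outcome `Y`: always `1` when
`Y = 1`, a fair coin when `Y = 0`. -/
structure BinaryRSV (Q : Measure Ω) (Y R : Ω → Bool) : Prop where
  inter_true : Q.real ({ω | Y ω = true} ∩ {ω | R ω = true}) = Q.real {ω | Y ω = true}
  inter_false : Q.real ({ω | Y ω = false} ∩ {ω | R ω = true}) = Q.real {ω | Y ω = false} / 2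

namespace BinaryRSV

variable {Q : Measure Ω} [IsProbabilityMeasure Q] {Y R : Ω → Bool}

lemma of_cond (hY : Measurable Y)
    (h1 : Q[|{ω | Y ω = true}] {ω | R ω = true} = 1)
    (h0 : Q[|{ω | Y ω = false}] {ω | R ω = true} = 1 / 2) : BinaryRSV Q Y R where
  inter_true := by
    have h := cond_mul_eq_inter (measurableSet_eq_bool hY true) {ω | R ω = true} Q
    rw [h1, one_mul] at h
    simp [measureReal_def, h]
  inter_false := by
    have h := cond_mul_eq_inter (measurableSet_eq_bool hY false) {ω | R ω = true} Q
    rw [h0] at h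
    simp [measureReal_def, ← h]
    ring

lemma measureReal_rsv_true (h : BinaryRSV Q Y R) (hY : Measurable Y) :
    Q.real {ω | R ω = true} = (1 + Q.real {ω | Y ω = true}) / 2 := by
  rw [measureReal_split_bool hY, h.inter_true, h.inter_false, measureReal_false_eq hY]
  ring

lemma integral_cond_true (h : BinaryRSV Q Y R) (hY : Measurable Y) (hR : Measurable R) :
    ∫ ω, b2r (Y ω) ∂(Q[|{ω | R ω = true}]) =
      2 * Q.real {ω | Y ω = true} / (1 + Q.real {ω | Y ω = true}) := by
  rw [integral_b2r hY, cond_measureReal_apply (measurableSet_eq_bool hR true), Set.inter_comm,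
    h.inter_true, h.measureReal_rsv_true hY]
  have : 0 ≤ Q.real {ω | Y ω = true} := measureReal_nonneg
  field_simp

lemma integral_cond_false (h : BinaryRSV Q Y R) (hY : Measurable Y) (hR : Measurable R) :
    ∫ ω, b2r (Y ω) ∂(Q[|{ω | R ω = false}]) = 0 := by
  have h1 := measureReal_split_bool (Q := Q) hR {ω | Y ω = true}
  rw [Set.inter_comm, h.inter_true] at h1
  rw [integral_b2r hY, cond_measureReal_apply (measurableSet_eq_bool hR false)]
  have h2 : Q.real ({ω | R ω = false} ∩ {ω | Y ω = true}) = 0 := by linarith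
  rw [h2, mul_zero]

end BinaryRSV

lemma cond_congr_ae {P : Measure Ω} {A B : Set Ω} (h : A =ᵐ[P] B) : P[|A] = P[|B] := by
  simp only [ProbabilityTheory.cond, measure_congr h, Measure.restrict_congr_set h]

/-- Under randomization, the potential outcome and the realized outcome agree in conditional law
within a treatment arm. -/
lemma IndepFun.measureReal_eq_cond {Q : Measure Ω} [IsProbabilityMeasure Q] {D Z Y : Ω → Bool}
    (hind : IndepFun D Z Q) (hD : Measurable D) {d : Bool}
    (hpos : Q {ω | D ω = d} ≠ 0) (hYZ : ∀ ω, D ω = d → Y ω = Z ω) :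
    Q.real {ω | Z ω = true} = (Q[|{ω | D ω = d}]).real {ω | Y ω = true} := by
  have hset : {ω | D ω = d} ∩ {ω | Y ω = true} = D ⁻¹' {d} ∩ Z ⁻¹' {true} := by
    ext ω
    simp only [Set.mem_inter_iff, Set.mem_ofPred_eq, Set.mem_preimage, Set.mem_singleton_iff]
    exact and_congr_right fun h => by rw [hYZ ω h]
  have hm := hind.measure_inter_preimage_eq_mul {d} {true} (measurableSet_singleton _)
    (measurableSet_singleton _)
  rw [cond_measureReal_apply (measurableSet_eq_bool hD d), hset, measureReal_def (s := _ ∩ _), hm,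
    ENNReal.toReal_mul]
  have hne : (Q {ω | D ω = d}).toReal ≠ 0 := ENNReal.toReal_ne_zero.2 ⟨hpos, measure_ne_top _ _⟩
  exact (inv_mul_cancel_left₀ hne _).symm

end Helpers

/-- **Proposition (Bias of common practice can have either sign), binary RSV DGP.**
Under the specific RSV mechanism `P(R=1|S,D,Y=1) = 1`, `P(R=1|S,D,Y=0) = 1/2`,
the bias of the common-practice estimand is `θ̃ − θ = (a − b)/(a + 1)`, which is
positive when `a > b` and negative when `a < b`. -/
theorem statement5
    {Ω : Type*} [MeasurableSpace Ω]
    (P : Measure Ω) [IsProbabilityMeasure P]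
    (S : Ω → Sample) (D : Ω → Bool) (Y0 Y1 : Ω → Bool) (R : Ω → Bool)
    (hS : Measurable S) (hD : Measurable D) (hY0 : Measurable Y0) (hY1 : Measurable Y1)
    (hR : Measurable R)
    (Y : Ω → Bool) (hYdef : ∀ ω, Y ω = if D ω then Y1 ω else Y0 ω)
    -- Randomization: D ⫫ (Y(0), Y(1)) under P(·|S = e)
    (randomization :
      IndepFun D (fun ω => (Y0 ω, Y1 ω)) (P[|{ω | S ω = Sample.e}]))
    -- Positivity
    (positivity_e : ∀ d y : Bool,
      0 < P {ω | S ω = Sample.e ∧ D ω = d ∧ Y ω = y})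
    (positivity_o : ∀ y : Bool, 0 < P {ω | S ω = Sample.o ∧ Y ω = y})
    -- Observational sample untreated: P(D = 1, S = o) = 0
    (untreated_o : P {ω | D ω = true ∧ S ω = Sample.o} = 0)
    -- Sample exchangeability: law(Y, R | S = e, D = d) = law(Y, R | S = o, D = d)
    (exchangeability : ∀ d : Bool,
      0 < P {ω | S ω = Sample.e ∧ D ω = d} →
      0 < P {ω | S ω = Sample.o ∧ D ω = d} →
      (P[|{ω | S ω = Sample.e ∧ D ω = d}]).map (fun ω => (Y ω, R ω)) =
        (P[|{ω | S ω = Sample.o ∧ D ω = d}]).map (fun ω => (Y ω, R ω)))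
    -- Specific RSV mechanism: P(R=1 | S=s, D=d, Y=1) = 1, P(R=1 | S=s, D=d, Y=0) = 1/2
    (mech1 : ∀ (s : Sample) (d : Bool),
      0 < P {ω | S ω = s ∧ D ω = d ∧ Y ω = true} →
      (P[|{ω | S ω = s ∧ D ω = d ∧ Y ω = true}]) {ω | R ω = true} = 1)
    (mech0 : ∀ (s : Sample) (d : Bool),
      0 < P {ω | S ω = s ∧ D ω = d ∧ Y ω = false} →
      (P[|{ω | S ω = s ∧ D ω = d ∧ Y ω = false}]) {ω | R ω = true} = 1 / 2)
    -- g(r) := E[Y | R = r, S = o]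
    (g : Bool → ℝ)
    (hg : ∀ r, g r = ∫ ω, b2r (Y ω) ∂(P[|{ω | R ω = r ∧ S ω = Sample.o}]))
    -- θ̃ := E[g(R) | D = 1, S = e] − E[g(R) | D = 0, S = e]
    (θt : ℝ)
    (hθt : θt = (∫ ω, g (R ω) ∂(P[|{ω | D ω = true ∧ S ω = Sample.e}])) -
      (∫ ω, g (R ω) ∂(P[|{ω | D ω = false ∧ S ω = Sample.e}])))
    -- θ := E[Y(1) − Y(0) | S = e]
    (θ : ℝ)
    (hθ : θ = ∫ ω, (b2r (Y1 ω) - b2r (Y0 ω)) ∂(P[|{ω | S ω = Sample.e}]))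
    -- a := P(Y(0) = 1 | S = e), b := P(Y(1) = 1 | S = e)
    (a b : ℝ)
    (ha : a = ((P[|{ω | S ω = Sample.e}]) {ω | Y0 ω = true}).toReal)
    (hb : b = ((P[|{ω | S ω = Sample.e}]) {ω | Y1 ω = true}).toReal) :
    θt - θ = (a - b) / (a + 1) ∧
      (a > b → θt - θ > 0) ∧ (a < b → θt - θ < 0) := by
  have hYm : Measurable Y := by
    rw [funext hYdef]
    exact Measurable.ite (measurableSet_eq_bool hD true) hY1 hY0
  have hSm (s : Sample) : MeasurableSet {ω | S ω = s} := hS (measurableSet_singleton s)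
  have hSDm (s : Sample) (d : Bool) : MeasurableSet {ω | S ω = s ∧ D ω = d} :=
    (hSm s).inter (measurableSet_eq_bool hD d)
  have hpos_e (d : Bool) : P {ω | S ω = Sample.e ∧ D ω = d} ≠ 0 :=
    ((positivity_e d true).trans_le (measure_mono fun ω (h : _ ∧ _) => And.intro h.1 h.2.1)).ne'
  have hoD (A : Set Ω) :
      ({ω | S ω = Sample.o} ∩ A : Set Ω) =ᵐ[P] ({ω | S ω = Sample.o ∧ D ω = false} ∩ A : Set Ω) := by
    have hnull : ∀ᵐ ω ∂P, ¬(D ω = true ∧ S ω = Sample.o) := by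
      rw [ae_iff]
      simpa using untreated_o
    filter_upwards [hnull] with ω hω
    have h : S ω = Sample.o ↔ S ω = Sample.o ∧ D ω = false :=
      ⟨fun h => ⟨h, Bool.eq_false_iff.2 fun h' => hω ⟨h', h⟩⟩, fun h => h.1⟩
    exact propext (and_congr_left fun _ => h)
  have hpos_oy (y : Bool) : 0 < P ({ω | S ω = Sample.o ∧ D ω = false} ∩ {ω | Y ω = y}) := by
    rw [← measure_congr (hoD _)]
    exact positivity_o y
  have hpos_o : P {ω | S ω = Sample.o ∧ D ω = false} ≠ 0 :=
    ((hpos_oy true).trans_le (measure_mono Set.inter_subset_left)).ne'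
  have hset (s : Sample) (d y : Bool) :
      {ω | S ω = s ∧ D ω = d} ∩ {ω | Y ω = y} = {ω | S ω = s ∧ D ω = d ∧ Y ω = y} := by
    ext ω
    exact and_assoc
  have hrsv (s : Sample) (d : Bool) (hsd : P {ω | S ω = s ∧ D ω = d} ≠ 0)
      (hy : ∀ y, 0 < P {ω | S ω = s ∧ D ω = d ∧ Y ω = y}) :
      BinaryRSV (P[|{ω | S ω = s ∧ D ω = d}]) Y R := by
    have := cond_isProbabilityMeasure hsd
    refine .of_cond hYm ?_ ?_ <;>
      rw [cond_cond_eq_cond_inter (hSDm s d) (measurableSet_eq_bool hYm _), hset]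
    exacts [mech1 s d (hy true), mech0 s d (hy false)]
  have hrsv_e (d : Bool) := hrsv Sample.e d (hpos_e d) (positivity_e d)
  have hrsv_o := hrsv Sample.o false hpos_o fun y => hset _ _ y ▸ hpos_oy y
  have hprob_e (d : Bool) := cond_isProbabilityMeasure (hpos_e d)
  have hprob_o := cond_isProbabilityMeasure hpos_o
  have hpos_S : P {ω | S ω = Sample.e} ≠ 0 :=
    ((pos_iff_ne_zero.2 (hpos_e true)).trans_le (measure_mono fun ω (h : _ ∧ _) => h.1)).ne'
  have hprob_S := cond_isProbabilityMeasure hpos_S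
  have hposD (d : Bool) : P[|{ω | S ω = Sample.e}] {ω | D ω = d} ≠ 0 :=
    (cond_pos_of_inter_ne_zero (hSm _) (hpos_e d)).ne'
  have hcondD (d : Bool) : (P[|{ω | S ω = Sample.e}])[|{ω | D ω = d}] =
      P[|{ω | S ω = Sample.e ∧ D ω = d}] :=
    cond_cond_eq_cond_inter (hSm _) (measurableSet_eq_bool hD d) P
  have ha' : a = (P[|{ω | S ω = Sample.e ∧ D ω = false}]).real {ω | Y ω = true} := by
    rw [ha, ← hcondD]
    exact IndepFun.measureReal_eq_cond (randomization.comp measurable_id measurable_fst) hD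
      (hposD false) fun ω (h : D ω = _) => by simp [hYdef, h]
  have hb' : b = (P[|{ω | S ω = Sample.e ∧ D ω = true}]).real {ω | Y ω = true} := by
    rw [hb, ← hcondD]
    exact IndepFun.measureReal_eq_cond (randomization.comp measurable_id measurable_snd) hD
      (hposD true) fun ω (h : D ω = _) => by simp [hYdef, h]
  have hao : (P[|{ω | S ω = Sample.o ∧ D ω = false}]).real {ω | Y ω = true} = a := by
    have hex := congrArg (fun μ : Measure (Bool × Bool) => μ.real (Prod.fst ⁻¹' {true}))
      (exchangeability false (pos_iff_ne_zero.2 (hpos_e false)) (pos_iff_ne_zero.2 hpos_o))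
    have hfst : MeasurableSet (Prod.fst ⁻¹' {true} : Set (Bool × Bool)) :=
      measurable_fst (measurableSet_singleton _)
    simp only [map_measureReal_apply (hYm.prodMk hR) hfst] at hex
    rw [ha']
    exact hex.symm
  have hcondR (r : Bool) : P[|{ω | R ω = r ∧ S ω = Sample.o}] =
      (P[|{ω | S ω = Sample.o ∧ D ω = false}])[|{ω | R ω = r}] := by
    rw [cond_cond_eq_cond_inter (hSDm _ _) (measurableSet_eq_bool hR r),
      ← cond_congr_ae (hoD {ω | R ω = r}), Set.inter_comm]
    rfl
  have hg1 : g true = 2 * a / (1 + a) := by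
    rw [hg, hcondR, hrsv_o.integral_cond_true hYm hR, hao]
  have hg0 : g false = 0 := by
    rw [hg, hcondR, hrsv_o.integral_cond_false hYm hR]
  have hθd (d : Bool) : ∫ ω, g (R ω) ∂(P[|{ω | D ω = d ∧ S ω = Sample.e}]) =
      2 * a / (1 + a) *
        ((1 + (P[|{ω | S ω = Sample.e ∧ D ω = d}]).real {ω | Y ω = true}) / 2) := by
    simp only [and_comm (a := D _ = d)]
    rw [integral_comp_bool hR, hg1, hg0, (hrsv_e d).measureReal_rsv_true hYm, zero_mul, add_zero]
  have hθ' : θ = b - a := by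
    rw [hθ, integral_sub (integrable_b2r hY1) (integrable_b2r hY0), integral_b2r hY1,
      integral_b2r hY0, ha, hb]
    rfl
  have ha0 : 0 ≤ a := ha ▸ ENNReal.toReal_nonneg
  have ha1 : 0 < a + 1 := by linarith
  have hbias : θt - θ = (a - b) / (a + 1) := by
    rw [hθt, hθd, hθd, ← ha', ← hb', hθ', add_comm 1 a]
    field_simp
    ring
  refine ⟨hbias, fun h => ?_, fun h => ?_⟩ <;> rw [hbias]
  · exact div_pos (sub_pos.2 h) ha1
  · exact div_neg_of_neg_of_pos (sub_neg.2 h) ha1
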